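/- Fix a partition of {1,…,n} into N nonempty blocks B_1,…,B_N, and let X ∈ ℂ^{n×n} be Hermitian positive semidefinite with blocks X_{αβ}. Define the block comparison matrix M_b(X) ∈ ℝ^{N×N} by (M_b(X))_{αα} = λ_min(X_{αα}) (the smallest eigenvalue of the diagonal block) and (M_b(X))_{αβ} = −‖X_{αβ}‖ for α ≠ β, where ‖·‖ is the largest singular value. If M_b(X) is positive semidefinite, then X has block coherence number at most 2. -/

import Mathlib

open Matrix BigOperators
open scoped ComplexOrder

/-- With respect to the partition of `Fin n` into the fibers of a surjective block-labelling
map `blk : Fin n → Fin N`, a matrix `X` has block coherence number at most `k` if it can be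
written as a finite sum `∑ j, v_j v_j†` where each `v_j` is supported on the union of at
most `k` blocks. -/
def BlockCohLE {n N : ℕ} (blk : Fin n → Fin N) (k : ℕ)
    (X : Matrix (Fin n) (Fin n) ℂ) : Prop :=
  ∃ (m : ℕ) (v : Fin m → Fin n → ℂ),
    X = ∑ j, Matrix.vecMulVec (v j) (star (v j)) ∧
    ∀ j, ∃ S : Finset (Fin N), S.card ≤ k ∧ ∀ i, v j i ≠ 0 → blk i ∈ S

/-- The operator norm (largest singular value) of a complex matrix. -/
noncomputable def opNorm {ι κ : Type*} [Fintype ι] [Fintype κ] [DecidableEq κ]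
    (A : Matrix ι κ ℂ) : ℝ :=
  ‖LinearMap.toContinuousLinearMap (Matrix.toEuclideanLin A)‖

/-- Symmetric PSD matrices with nonpositive off-diagonal have a positive supersolution. -/
lemma exists_pos_super : ∀ (N : ℕ) (M : Fin N → Fin N → ℝ), (∀ i j, M i j = M j i) →
    (∀ i j, i ≠ j → M i j ≤ 0) → (∀ x : Fin N → ℝ, 0 ≤ ∑ i, ∑ j, x i * M i j * x j) →
    ∃ d : Fin N → ℝ, (∀ i, 0 < d i) ∧ ∀ i, 0 ≤ ∑ j, M i j * d j := by
  intro N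
  induction N with
  | zero => intro M _ _ _; exact ⟨fun _ => 1, fun i => i.elim0, fun i => i.elim0⟩
  | succ N ih =>
    intro M hs ho hp
    have key : ∀ (t : ℝ) (y : Fin N → ℝ), 0 ≤ M 0 0 * t ^ 2 + 2 * t * (∑ j, M 0 j.succ * y j)
        + ∑ i, ∑ j, y i * M i.succ j.succ * y j := by
      intro t y
      have := hp (Fin.cons t y)
      simp only [Fin.sum_univ_succ, Fin.cons_zero, Fin.cons_succ, Finset.sum_add_distrib] at this
      have e1 : ∑ i : Fin N, y i * M i.succ 0 * t = t * ∑ j, M 0 j.succ * y j := by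
        rw [Finset.mul_sum]; refine Finset.sum_congr rfl fun i _ => ?_
        rw [hs i.succ 0]; ring
      have e2 : ∑ i : Fin N, t * M 0 i.succ * y i = t * ∑ j, M 0 j.succ * y j := by
        rw [Finset.mul_sum]; refine Finset.sum_congr rfl fun i _ => ?_
        ring
      rw [e1, e2] at this
      nlinarith [this]
    have h00 : 0 ≤ M 0 0 := by simpa using key 1 0
    have hneg : ∀ j : Fin N, M 0 j.succ ≤ 0 := fun j => ho _ _ (Fin.succ_ne_zero j).symm
    rcases h00.eq_or_lt with h0 | hpos
    · -- zero pivot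
      have hz : ∀ j : Fin N, M 0 j.succ = 0 := by
        intro k
        by_contra hk
        have hk' : ∀ t : ℝ, 0 ≤ 2 * t * M 0 k.succ + M k.succ k.succ := by
          intro t
          have := key t (Pi.single k 1)
          simpa [← h0, Pi.single_apply] using this
        have := hk' (-(M k.succ k.succ + 1) / (2 * M 0 k.succ))
        have e : 2 * (-(M k.succ k.succ + 1) / (2 * M 0 k.succ)) * M 0 k.succ
          = -(M k.succ k.succ + 1) := by field_simp
        linarith
      obtain ⟨d, hd, hd'⟩ := ih (fun i j => M i.succ j.succ) (fun i j => hs _ _)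
        (fun i j hij => ho _ _ (by simpa using hij)) (fun x => by simpa using key 0 x)
      refine ⟨Fin.cons 1 d, ?_, ?_⟩
      · intro i; refine Fin.cases ?_ (fun i => ?_) i <;> simp [hd]
      · intro i; refine Fin.cases ?_ (fun i => ?_) i
        · simp [Fin.sum_univ_succ, hz, ← h0]
        · simpa [Fin.sum_univ_succ, hz, hs _ 0] using hd' i
    · obtain ⟨d, hd, hd'⟩ := ih
        (fun i j => M i.succ j.succ - M 0 i.succ * M 0 j.succ / M 0 0)
        (fun i j => by simp only [hs i.succ j.succ]; ring)
        (fun i j hij => by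
          have h1 := ho i.succ j.succ (by simpa using hij)
          have h2 : 0 ≤ M 0 i.succ * M 0 j.succ / M 0 0 :=
            div_nonneg (mul_nonneg_of_nonpos_of_nonpos (hneg i) (hneg j)) h00
          linarith)
        (fun y => by
          set S := ∑ j, M 0 j.succ * y j with hS
          have h1 := key (-S / M 0 0) y
          have e : ∑ i, ∑ j, y i * (M i.succ j.succ - M 0 i.succ * M 0 j.succ / M 0 0) * y j
              = (∑ i, ∑ j, y i * M i.succ j.succ * y j) - S * S / M 0 0 := by
            rw [hS, Finset.sum_mul_sum, Finset.sum_div, ← Finset.sum_sub_distrib]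
            refine Finset.sum_congr rfl fun i _ => ?_
            rw [Finset.sum_div, ← Finset.sum_sub_distrib]
            refine Finset.sum_congr rfl fun j _ => ?_
            ring
          rw [e]
          rw [← hS] at h1
          have e2 : M 0 0 * (-S / M 0 0) ^ 2 + 2 * (-S / M 0 0) * S = - (S * S / M 0 0) := by
            field_simp; ring
          linarith)
      set S := ∑ j, M 0 j.succ * d j with hS
      have hS0 : S ≤ 0 := Finset.sum_nonpos fun j _ =>
        mul_nonpos_of_nonpos_of_nonneg (hneg j) (hd j).le
      have hd2 : ∀ i : Fin N, 0 ≤ (∑ j, M i.succ j.succ * d j) - M 0 i.succ * S / M 0 0 := by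
        intro i
        have := hd' i
        convert this using 1
        rw [hS, Finset.mul_sum, Finset.sum_div, ← Finset.sum_sub_distrib]
        refine Finset.sum_congr rfl fun j _ => ?_
        ring
      rcases hS0.eq_or_lt with hSz | hSn
      · refine ⟨Fin.cons 1 d, ?_, ?_⟩
        · intro i; refine Fin.cases ?_ (fun i => ?_) i <;> simp [hd]
        · have hz : ∀ j : Fin N, M 0 j.succ = 0 := by
            have := (Finset.sum_eq_zero_iff_of_nonpos (fun j _ =>
              mul_nonpos_of_nonpos_of_nonneg (hneg j) (hd j).le)).1 hSz
            intro j
            have := this j (Finset.mem_univ _)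
            simpa [(hd j).ne'] using this
          intro i; refine Fin.cases ?_ (fun i => ?_) i
          · simp [Fin.sum_univ_succ, hz, h00]
          · have := hd2 i
            simpa [Fin.sum_univ_succ, hz, hs _ 0] using this
      · refine ⟨Fin.cons (-S / M 0 0) d, ?_, ?_⟩
        · intro i; refine Fin.cases ?_ (fun i => ?_) i
          · simpa using div_pos (neg_pos.2 hSn) hpos
          · simp [hd]
        · intro i; refine Fin.cases ?_ (fun i => ?_) i
          · simp only [Fin.sum_univ_succ, Fin.cons_zero, Fin.cons_succ]
            rw [← hS]
            apply le_of_eq; field_simp; ring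
          · simp only [Fin.sum_univ_succ, Fin.cons_zero, Fin.cons_succ]
            have := hd2 i
            rw [hs i.succ 0]
            have e : M 0 i.succ * (-S / M 0 0) = - (M 0 i.succ * S / M 0 0) := by ring
            linarith

lemma blockCoh_of_psd {n N : ℕ} (blk : Fin n → Fin N) (k : ℕ) (S : Finset (Fin N))
    (hS : S.card ≤ k) (W : Matrix (Fin n) (Fin n) ℂ) (hW : W.PosSemidef)
    (hsupp : ∀ i, blk i ∉ S → W i i = 0) : BlockCohLE blk k W := by
  obtain ⟨m, v, hv⟩ := Matrix.posSemidef_iff_eq_sum_vecMulVec.mp hW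
  refine ⟨m, v, hv, fun j => ⟨S, hS, fun i hi => ?_⟩⟩
  by_contra hc
  have h0 := hsupp i hc
  rw [hv, Matrix.sum_apply] at h0
  have h1 : ∑ c, Complex.normSq (v c i) = 0 := by
    have : ((∑ c, Complex.normSq (v c i) : ℝ) : ℂ) = 0 := by
      rw [← h0]; push_cast
      refine Finset.sum_congr rfl fun c _ => ?_
      simp [vecMulVec_apply, Complex.mul_conj]
    exact_mod_cast this
  have h2 := (Finset.sum_eq_zero_iff_of_nonneg (fun c _ => Complex.normSq_nonneg (v c i))).1 h1 j
    (Finset.mem_univ _)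
  exact hi (Complex.normSq_eq_zero.1 h2)

lemma blockCoh_zero {n N : ℕ} (blk : Fin n → Fin N) (k : ℕ) :
    BlockCohLE blk k (0 : Matrix (Fin n) (Fin n) ℂ) :=
  ⟨0, fun _ _ => 0, by simp, fun j => j.elim0⟩

lemma blockCoh_add {n N : ℕ} (blk : Fin n → Fin N) (k : ℕ) (A B : Matrix (Fin n) (Fin n) ℂ)
    (hA : BlockCohLE blk k A) (hB : BlockCohLE blk k B) : BlockCohLE blk k (A + B) := by
  obtain ⟨a, v, hv, hv'⟩ := hA
  obtain ⟨b, w, hw, hw'⟩ := hB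
  refine ⟨a + b, Fin.append v w, ?_, ?_⟩
  · rw [Fin.sum_univ_add, hv, hw]; simp
  · intro j
    refine Fin.addCases (fun j => ?_) (fun j => ?_) j
    · simpa using hv' j
    · simpa using hw' j

lemma blockCoh_sum {n N : ℕ} (blk : Fin n → Fin N) (k : ℕ) {ι : Type*} (s : Finset ι)
    (A : ι → Matrix (Fin n) (Fin n) ℂ)
    (hA : ∀ i ∈ s, BlockCohLE blk k (A i)) : BlockCohLE blk k (∑ i ∈ s, A i) :=
  Finset.sum_induction A (BlockCohLE blk k) (blockCoh_add blk k) (blockCoh_zero blk k) hA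

/-- Block restriction of a vector. -/
noncomputable def blkVec {n N : ℕ} (blk : Fin n → Fin N) (α : Fin N) (x : Fin n → ℂ) :
    EuclideanSpace ℂ {i : Fin n // blk i = α} := WithLp.toLp 2 (fun i => x i)

/-- Block projection. -/
noncomputable def blkProj {n N : ℕ} (blk : Fin n → Fin N) (α : Fin N) :
    Matrix (Fin n) (Fin n) ℂ := diagonal (fun i => if blk i = α then 1 else 0)

lemma blkProj_herm {n N : ℕ} (blk : Fin n → Fin N) (α : Fin N) :
    (blkProj blk α)ᴴ = blkProj blk α := by
  unfold blkProj
  rw [diagonal_conjTranspose]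
  congr 1; ext i; simp only [Pi.star_apply]; split_ifs <;> simp

lemma sum_blk {n N : ℕ} (blk : Fin n → Fin N) (α : Fin N) (f : Fin n → ℂ) :
    ∑ i : {i : Fin n // blk i = α}, f i = ∑ i, if blk i = α then f i else 0 := by
  rw [← Finset.sum_filter]
  exact (Finset.sum_subtype (Finset.univ.filter fun i => blk i = α) (by simp) f).symm

lemma quad_proj {n N : ℕ} (blk : Fin n → Fin N) (α : Fin N) (x : Fin n → ℂ) :
    star x ⬝ᵥ (blkProj blk α *ᵥ x) = ((‖blkVec blk α x‖ ^ 2 : ℝ) : ℂ) := by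
  rw [EuclideanSpace.norm_sq_eq]
  simp only [blkProj, blkVec, mulVec_diagonal, dotProduct, Pi.star_apply]
  push_cast
  rw [sum_blk blk α (fun i => (‖x i‖ : ℂ) ^ 2)]
  refine Finset.sum_congr rfl fun i _ => ?_
  split_ifs
  · rw [← Complex.conj_mul']; simp
  · simp

lemma quad_block {n N : ℕ} (blk : Fin n → Fin N) (α β : Fin N) (X : Matrix (Fin n) (Fin n) ℂ)
    (x : Fin n → ℂ) :
    star x ⬝ᵥ ((blkProj blk α * X * blkProj blk β) *ᵥ x) =
    inner ℂ (blkVec blk α x) (toEuclideanLin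
      (X.submatrix (fun i : {i : Fin n // blk i = α} => (i : Fin n))
          (fun i : {i : Fin n // blk i = β} => (i : Fin n))) (blkVec blk β x)) := by
  have e : ∀ i : {i : Fin n // blk i = α}, (∑ j : {j : Fin n // blk j = β}, X i j * x j)
      = (fun i : Fin n => ∑ j, if blk j = β then X i j * x j else 0) i := fun i =>
    sum_blk blk β (fun j => X i j * x j)
  rw [EuclideanSpace.inner_eq_star_dotProduct, Matrix.toLpLin_apply, dotProduct_comm]
  simp only [blkProj, blkVec, dotProduct, mulVec, Pi.star_apply, submatrix_apply]
  simp_rw [e]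
  rw [sum_blk blk α (fun i => (∑ j, if blk j = β then X i j * x j else 0) * star (x i))]
  refine Finset.sum_congr rfl fun i _ => ?_
  simp only [mul_diagonal, diagonal_mul]
  split_ifs
  · congr 1
    refine Finset.sum_congr rfl fun j _ => ?_
    split_ifs <;> simp
  · simp

lemma quad_block_norm {n N : ℕ} (blk : Fin n → Fin N) (α β : Fin N)
    (X : Matrix (Fin n) (Fin n) ℂ) (x : Fin n → ℂ) :
    ‖star x ⬝ᵥ ((blkProj blk α * X * blkProj blk β) *ᵥ x)‖ ≤
    opNorm (X.submatrix (fun i : {i : Fin n // blk i = α} => (i : Fin n))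
          (fun i : {i : Fin n // blk i = β} => (i : Fin n))) *
      ‖blkVec blk α x‖ * ‖blkVec blk β x‖ := by
  rw [quad_block]
  refine (norm_inner_le_norm _ _).trans ?_
  have := (LinearMap.toContinuousLinearMap (Matrix.toEuclideanLin
    (X.submatrix (fun i : {i : Fin n // blk i = α} => (i : Fin n))
          (fun i : {i : Fin n // blk i = β} => (i : Fin n))))).le_opNorm (blkVec blk β x)
  have h2 := mul_le_mul_of_nonneg_left this (norm_nonneg (blkVec blk α x))
  refine h2.trans (le_of_eq ?_)
  unfold opNorm; ring

lemma min_eig {ι : Type*} [Fintype ι] [DecidableEq ι] (A : Matrix ι ι ℂ) (hA : A.IsHermitian)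
    (y : EuclideanSpace ℂ ι) :
    (⨅ i, hA.eigenvalues i) * ‖y‖ ^ 2 ≤ (inner ℂ y (toEuclideanLin A y)).re := by
  have h1 : inner ℂ y (toEuclideanLin A y) =
      ∑ i, ((hA.eigenvalues i * ‖inner ℂ (hA.eigenvectorBasis i) y‖ ^ 2 : ℝ) : ℂ) := by
    rw [← hA.eigenvectorBasis.sum_inner_mul_inner]
    refine Finset.sum_congr rfl fun i _ => ?_
    have hs : (toEuclideanLin A).IsSymmetric := Matrix.isSymmetric_toEuclideanLin_iff.mpr hA
    have he : toEuclideanLin A (hA.eigenvectorBasis i) =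
      (hA.eigenvalues i : ℂ) • hA.eigenvectorBasis i := by
      rw [Matrix.toLpLin_apply, hA.mulVec_eigenvectorBasis]
      ext k; simp
    rw [← hs, he, inner_smul_left]
    rw [← inner_conj_symm y]
    push_cast
    rw [← Complex.conj_mul']
    simp; ring
  rw [h1, ← Complex.ofReal_sum, Complex.ofReal_re, ← hA.eigenvectorBasis.sum_sq_norm_inner_right,
    Finset.mul_sum]
  refine Finset.sum_le_sum fun i _ => ?_
  exact mul_le_mul_of_nonneg_right (ciInf_le (Set.finite_range _).bddBelow i) (sq_nonneg _)

/-- The two-block pieces. -/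
noncomputable def pairPiece {n N : ℕ} (blk : Fin n → Fin N) (X : Matrix (Fin n) (Fin n) ℂ)
    (c : Fin N → Fin N → ℝ) (α β : Fin N) : Matrix (Fin n) (Fin n) ℂ :=
  (1 / 2 : ℂ) • (blkProj blk α * X * blkProj blk β + blkProj blk β * X * blkProj blk α
    + (c α β : ℂ) • blkProj blk α + (c β α : ℂ) • blkProj blk β)

lemma pairPiece_herm {n N : ℕ} (blk : Fin n → Fin N) (X : Matrix (Fin n) (Fin n) ℂ)
    (hX : X.IsHermitian) (c : Fin N → Fin N → ℝ) (α β : Fin N) :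
    (pairPiece blk X c α β).IsHermitian := by
  unfold pairPiece Matrix.IsHermitian
  simp only [conjTranspose_smul, conjTranspose_add, conjTranspose_mul, blkProj_herm, hX.eq,
    Matrix.mul_assoc]
  simp
  abel

lemma sum_blkProj {n N : ℕ} (blk : Fin n → Fin N) : ∑ α, blkProj blk α = 1 := by
  ext i j
  rw [Matrix.sum_apply]
  by_cases h : i = j
  · subst h; simp [blkProj]
  · simp [blkProj, h]

lemma sum_pairPiece {n N : ℕ} (blk : Fin n → Fin N) (X : Matrix (Fin n) (Fin n) ℂ)
    (c : Fin N → Fin N → ℝ) (hc : ∀ α, ∑ β, c α β = 0) :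
    ∑ α, ∑ β, pairPiece blk X c α β = X := by
  have h1 : ∑ α, ∑ β, blkProj blk α * X * blkProj blk β = X := by
    simp_rw [← Finset.mul_sum, sum_blkProj, Matrix.mul_one, ← Finset.sum_mul, sum_blkProj,
      Matrix.one_mul]
  have h2 : ∑ α, ∑ β, blkProj blk β * X * blkProj blk α = X := by
    rw [Finset.sum_comm]; exact h1
  have h3 : ∑ α, ∑ β, (c α β : ℂ) • blkProj blk α = 0 := by
    simp_rw [← Finset.sum_smul, ← Complex.ofReal_sum, hc]; simp
  have h4 : ∑ α, ∑ β, (c β α : ℂ) • blkProj blk β = 0 := by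
    rw [Finset.sum_comm]; exact h3
  unfold pairPiece
  simp_rw [← Finset.smul_sum, Finset.sum_add_distrib, h1, h2, h3, h4]
  rw [add_zero, add_zero, ← two_smul ℂ X, smul_smul]; norm_num

lemma pairPiece_diag {n N : ℕ} (blk : Fin n → Fin N) (X : Matrix (Fin n) (Fin n) ℂ)
    (c : Fin N → Fin N → ℝ) (α β : Fin N) (i : Fin n) (hi : blk i ∉ ({α, β} : Finset (Fin N))) :
    pairPiece blk X c α β i i = 0 := by
  simp only [Finset.mem_insert, Finset.mem_singleton, not_or] at hi
  simp [pairPiece, blkProj, mul_diagonal, diagonal_mul, hi.1, hi.2]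

lemma pairPiece_quad {n N : ℕ} (blk : Fin n → Fin N) (X : Matrix (Fin n) (Fin n) ℂ)
    (c : Fin N → Fin N → ℝ) (α β : Fin N) (x : Fin n → ℂ) :
    (star x ⬝ᵥ (pairPiece blk X c α β *ᵥ x)).re = (1 / 2) *
      ((star x ⬝ᵥ ((blkProj blk α * X * blkProj blk β) *ᵥ x)).re
      + (star x ⬝ᵥ ((blkProj blk β * X * blkProj blk α) *ᵥ x)).re
      + c α β * ‖blkVec blk α x‖ ^ 2 + c β α * ‖blkVec blk β x‖ ^ 2) := by
  unfold pairPiece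
  simp only [smul_mulVec, add_mulVec, dotProduct_smul, dotProduct_add, quad_proj, smul_eq_mul]
  rw [show (1 / 2 : ℂ) = ((1 / 2 : ℝ) : ℂ) by norm_num, Complex.re_ofReal_mul]
  simp only [Complex.add_re, Complex.re_ofReal_mul, Complex.ofReal_re]

/-- If the block comparison matrix `M_b(X)` — with diagonal entries the
smallest eigenvalues of the diagonal blocks and off-diagonal entries minus the operator
norms of the off-diagonal blocks — is positive semidefinite, then the Hermitian positive
semidefinite matrix `X` has block coherence number at most 2. -/
theorem block_comparison_matrix_blockCoh_two
    (n N : ℕ) (blk : Fin n → Fin N) (hblk : Function.Surjective blk)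
    (X : Matrix (Fin n) (Fin n) ℂ) (hX : X.PosSemidef)
    (Mb : Matrix (Fin N) (Fin N) ℝ)
    (hMb : ∀ α β, Mb α β =
      if α = β then
        ⨅ i, (hX.isHermitian.submatrix
          (fun i : {i : Fin n // blk i = α} => (i : Fin n))).eigenvalues i
      else
        - opNorm (X.submatrix (fun i : {i : Fin n // blk i = α} => (i : Fin n))
          (fun i : {i : Fin n // blk i = β} => (i : Fin n))))
    (hpsd : Mb.PosSemidef) :
    BlockCohLE blk 2 X := by
  have hsym : ∀ α β, Mb α β = Mb β α := fun α β => by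
    have := hpsd.isHermitian.apply α β
    simpa using this.symm
  obtain ⟨d, hd, hd'⟩ := exists_pos_super N Mb hsym
    (fun i j hij => by
      rw [hMb, if_neg hij]; unfold opNorm; exact neg_nonpos.2 (norm_nonneg _))
    (fun x => by
      have := hpsd.dotProduct_mulVec_nonneg x
      simp only [dotProduct, mulVec, Finset.mul_sum, star_trivial] at this
      simpa only [mul_assoc] using this)
  let c : Fin N → Fin N → ℝ := fun α β =>
    (if α = β then ∑ γ, Mb α γ * d γ / d α else 0) - Mb α β * d β / d α
  have hc : ∀ α, ∑ β, c α β = 0 := by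
    intro α
    simp only [c, Finset.sum_sub_distrib]
    simp
  have hcd : ∀ α, 0 ≤ c α α + Mb α α := by
    intro α
    have h1 : c α α + Mb α α = (∑ γ, Mb α γ * d γ) / d α := by
      simp only [c, if_true, Finset.sum_div]
      rw [mul_div_assoc, div_self (hd α).ne']; ring
    rw [h1]; exact div_nonneg (hd' α) (hd α).le
  rw [← sum_pairPiece blk X c hc]
  refine blockCoh_sum blk 2 _ _ fun α _ => blockCoh_sum blk 2 _ _ fun β _ => ?_
  refine blockCoh_of_psd blk 2 {α, β} Finset.card_le_two _ ?_
    (fun i hi => pairPiece_diag blk X c α β i hi)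
  have hH := pairPiece_herm blk X hX.isHermitian c α β
  refine PosSemidef.of_dotProduct_mulVec_nonneg hH fun x => ?_
  rw [Complex.nonneg_iff]
  refine ⟨?_, (hH.im_star_dotProduct_mulVec_self x).symm⟩
  rw [pairPiece_quad]
  refine mul_nonneg (by norm_num) ?_
  by_cases hab : α = β
  · subst hab
    have h1 := min_eig _ (hX.isHermitian.submatrix
          (fun i : {i : Fin n // blk i = α} => (i : Fin n))) (blkVec blk α x)
    rw [← quad_block] at h1
    have h2 := hMb α α
    rw [if_pos rfl] at h2
    rw [← h2] at h1
    have h3 := mul_nonneg (hcd α) (sq_nonneg ‖blkVec blk α x‖)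
    linarith
  · have h1 := quad_block_norm blk α β X x
    have h2 := quad_block_norm blk β α X x
    have e1 := hMb α β
    have e2 := hMb β α
    rw [if_neg hab] at e1
    rw [if_neg (Ne.symm hab)] at e2
    rw [hsym β α] at e2
    rw [← neg_eq_iff_eq_neg.2 e1] at h1
    rw [← neg_eq_iff_eq_neg.2 e2] at h2
    have g1 := (abs_le.1 ((Complex.abs_re_le_norm _).trans h1)).1
    have g2 := (abs_le.1 ((Complex.abs_re_le_norm _).trans h2)).1
    have hm : 0 ≤ - Mb α β := by
      rw [e1, neg_neg]; unfold opNorm; exact norm_nonneg _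
    have c1 : c α β = - Mb α β * (d β / d α) := by simp only [c, if_neg hab]; ring
    have c2 : c β α = - Mb α β * (d α / d β) := by
      simp only [c, if_neg (Ne.symm hab), hsym β α]; ring
    rw [c1, c2]
    set a := ‖blkVec blk α x‖
    set b := ‖blkVec blk β x‖
    have hα := hd α
    have hβ := hd β
    have h5 : 0 ≤ d β / d α * a ^ 2 + d α / d β * b ^ 2 - 2 * a * b := by
      have : d β / d α * a ^ 2 + d α / d β * b ^ 2 - 2 * a * b
        = (d β * a - d α * b) ^ 2 / (d α * d β) := by field_simp; ring
      rw [this]; positivity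
    have h6 := mul_nonneg hm h5
    nlinarith
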